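/- There do not exist functions φ_i (for i < ω) mapping the family of meager subsets of ℝ into the family of closed nowhere dense subsets of ℝ such that A ⊆ ⋃_{i<ω} φ_i(A) for every meager set A ⊆ ℝ, and φ_i(A) ⊆ φ_i(B) for all meager sets A ⊆ B ⊆ ℝ and every i < ω. -/

import Mathlib

open Set Topology TopologicalSpace

theorem isMeagre_singleton {X : Type*} [TopologicalSpace X] [T1Space X] (x : X) [(𝓝[≠] x).NeBot] :
    IsMeagre ({x} : Set X) :=
  (isClosed_singleton.isNowhereDense_iff.2 (interior_singleton x)).isMeagre

/-- A non-meager space without isolated points has a non-meager subset all of whose initial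
segments with respect to a fixed well-order are meager. -/
theorem exists_not_isMeagre_forall_initialSegment_isMeagre {X : Type*} [TopologicalSpace X]
    [T1Space X] [∀ x : X, (𝓝[≠] x).NeBot] (r : X → X → Prop) [IsWellOrder X r]
    (hX : ¬ IsMeagre (univ : Set X)) :
    ∃ s : Set X, ¬ IsMeagre s ∧ ∀ z ∈ s, IsMeagre {y ∈ s | ¬ r z y} := by
  obtain ⟨s, hs, hlt⟩ : ∃ s : Set X, ¬ IsMeagre s ∧ ∀ z ∈ s, IsMeagre {y | r y z} := by
    by_cases h : ∃ x, ¬ IsMeagre {y | r y x}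
    · obtain ⟨x, hx, hmin⟩ := (IsWellFounded.wf (r := r)).has_min {x | ¬ IsMeagre {y | r y x}} h
      exact ⟨_, hx, fun z hz => by_contra fun hz' => hmin z hz' hz⟩
    · push Not at h
      exact ⟨univ, hX, fun z _ => h z⟩
  refine ⟨s, hs, fun z hz => ((hlt z hz).union (isMeagre_singleton z)).mono ?_⟩
  rintro y ⟨-, hy⟩
  rcases trichotomous_of r y z with h | h | h
  exacts [Or.inl h, Or.inr h, absurd h hy]

/-- If all initial segments of a non-meager set are meager, then its countable subsets are
bounded. -/
theorem exists_forall_rel_of_countable {X : Type*} [TopologicalSpace X] {r : X → X → Prop}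
    {s c : Set X} (hs : ¬ IsMeagre s) (hseg : ∀ z ∈ s, IsMeagre {y ∈ s | ¬ r z y})
    (hc : c.Countable) (hcs : c ⊆ s) : ∃ x ∈ s, ∀ z ∈ c, r z x := by
  by_contra! h
  refine hs ((isMeagre_biUnion hc fun z hz => hseg z (hcs hz)).mono fun y hy => ?_)
  obtain ⟨z, hz, hzy⟩ := h y hy
  exact mem_biUnion hz ⟨hy, hzy⟩


/-- There do not exist functions `φ i` (for `i < ω`) mapping the family of meager subsets
of `ℝ` into the family of closed nowhere dense subsets of `ℝ` such that
`A ⊆ ⋃ i, φ i A` for every meager `A`, and `φ i A ⊆ φ i B` for all meager sets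
`A ⊆ B` and every `i`. -/
theorem no_monotone_closed_nwd_cover :
    ¬ ∃ φ : ℕ → Set ℝ → Set ℝ,
      (∀ (i : ℕ) (A : Set ℝ), IsMeagre A → IsClosed (φ i A) ∧ IsNowhereDense (φ i A)) ∧
      (∀ A : Set ℝ, IsMeagre A → A ⊆ ⋃ i : ℕ, φ i A) ∧
      (∀ (i : ℕ) (A B : Set ℝ), IsMeagre A → IsMeagre B → A ⊆ B → φ i A ⊆ φ i B) := by
  rintro ⟨φ, hφ, hcover, hmono⟩
  let r : ℝ → ℝ → Prop := WellOrderingRel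
  obtain ⟨s, hs, hseg⟩ := exists_not_isMeagre_forall_initialSegment_isMeagre r
    (not_isMeagre_of_isOpen isOpen_univ univ_nonempty)
  let A : ℝ → Set ℝ := fun z => {y ∈ s | ¬ r z y}
  let J : Set (ℕ × Set ℝ) :=
    {p | p.2 ∈ countableBasis ℝ ∧ ∃ z ∈ s, (φ p.1 (A z) ∩ p.2).Nonempty}
  have hJ : J.Countable :=
    (countable_univ.prod (countable_countableBasis ℝ)).mono fun p hp =>
      mk_mem_prod (mem_univ p.1) hp.1
  choose f hfs hf using fun p : J => p.2.2
  have : Countable J := hJ.to_subtype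
  obtain ⟨x, hxs, hx⟩ := exists_forall_rel_of_countable hs hseg (countable_range f)
    (range_subset_iff.2 hfs)
  have hstable : ∀ i, ∀ z ∈ s, φ i (A z) ⊆ φ i (A x) := by
    intro i z hz y hy
    rw [← (hφ i _ (hseg x hxs)).1.closure_eq, (isBasis_countableBasis ℝ).mem_closure_iff]
    intro o ho hyo
    have hp : (i, o) ∈ J := ⟨ho, z, hz, y, hy, hyo⟩
    have hsub : A (f ⟨_, hp⟩) ⊆ A x := fun w hw =>
      ⟨hw.1, fun hxw => hw.2 (trans_of r (hx _ (mem_range_self _)) hxw)⟩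
    obtain ⟨w, hw, hwo⟩ := hf ⟨_, hp⟩
    exact ⟨w, hwo, hmono i _ _ (hseg _ (hfs _)) (hseg x hxs) hsub hw⟩
  refine hs ((isMeagre_iUnion fun i => (hφ i _ (hseg x hxs)).2.isMeagre).mono fun y hy => ?_)
  obtain ⟨i, hi⟩ := mem_iUnion.1 (hcover _ (hseg y hy) ⟨hy, irrefl_of r y⟩)
  exact mem_iUnion.2 ⟨i, hstable i y hy hi⟩
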